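/- For every nonnegative integer p and every real number t with 0 ≤ t < 1, the series ∑_{k=0}^∞ [(k+p)!/k!]·H_{k+p}²·t^k converges and equals the p-th derivative, evaluated at t, of the function s ↦ [Li₂(s) + ln²(1−s)]/(1−s) on the interval (−1, 1). -/

import Mathlib

/-- The `k`-th harmonic number `H_k = ∑_{j=1}^k 1/j`, with `H_0 = 0`. -/
noncomputable def H (k : ℕ) : ℝ := ∑ j ∈ Finset.range k, (1 : ℝ) / (j + 1)

/-- The dilogarithm `Li₂(t) = ∑_{k=1}^∞ t^k / k²`. -/
noncomputable def Li2 (t : ℝ) : ℝ := ∑' k : ℕ, t ^ (k + 1) / ((k : ℝ) + 1) ^ 2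

open Filter Topology Finset in
/-- A power series converging on `(-1, 1)` may be differentiated termwise there. -/
theorem hasSum_deriv_of_hasSum_pow {a : ℕ → ℝ} {f : ℝ → ℝ}
    (hf : ∀ s ∈ Set.Ioo (-1 : ℝ) 1, HasSum (fun k => a k * s ^ k) (f s))
    {s : ℝ} (hs : s ∈ Set.Ioo (-1 : ℝ) 1) :
    HasSum (fun k : ℕ => ((k : ℝ) + 1) * a (k + 1) * s ^ k) (deriv f s) := by
  obtain ⟨r, hsr, hr1⟩ := exists_between (abs_lt.2 hs)
  obtain ⟨ρ, hrρ, hρ1⟩ := exists_between hr1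
  have hr0 : 0 < r := (abs_nonneg s).trans_lt hsr
  have hρ0 : 0 < ρ := hr0.trans hrρ
  have hbound : Summable fun n : ℕ => ‖(n * (a n * ρ ^ n)) * (r / ρ) ^ n‖ := by
    refine summable_norm_mul_geometric_of_norm_lt_one' (k := 1) ?_ ?_
    · rw [Real.norm_of_nonneg (by positivity)]
      exact (div_lt_one hρ0).2 hrρ
    · have h := (hf ρ ⟨by linarith, hρ1⟩).summable.tendsto_atTop_zero.isBigO_one ℝ
      simpa using (Asymptotics.isBigO_refl (fun n : ℕ => (n : ℝ)) atTop).mul h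
  have hu : Summable fun n : ℕ => |a n| * (n * r ^ (n - 1)) := by
    refine (hbound.mul_left r⁻¹).congr fun n => ?_
    rcases n with _ | n
    · simp
    · rw [div_pow, Real.norm_eq_abs]
      simp only [abs_mul, abs_div, abs_pow, abs_of_pos hr0, abs_of_pos hρ0, Nat.abs_cast,
        Nat.add_sub_cancel]
      field_simp
      ring
  have hsmem : s ∈ Set.Ioo (-r) r := abs_lt.1 hsr
  have hg' : ∀ (n : ℕ) (y : ℝ), y ∈ Set.Ioo (-r) r →
      ‖a n * (n * y ^ (n - 1))‖ ≤ |a n| * (n * r ^ (n - 1)) := by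
    intro n y hy
    rw [Real.norm_eq_abs, abs_mul, abs_mul, abs_pow, Nat.abs_cast]
    have := (abs_lt.2 hy).le
    gcongr
  have hd := hasDerivAt_tsum_of_isPreconnected (g := fun n z => a n * z ^ n) hu isOpen_Ioo
    isPreconnected_Ioo (fun n y _ => (hasDerivAt_pow n y).const_mul (a n)) hg' hsmem
    (hf s hs).summable hsmem
  have heq : f =ᶠ[𝓝 s] fun z => ∑' n, a n * z ^ n := by
    filter_upwards [Ioo_mem_nhds hs.1 hs.2] with z hz using (hf z hz).tsum_eq.symm
  have hfd := hd.congr_of_eventuallyEq heq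
  rw [hfd.deriv]
  have hsum := (Summable.of_norm_bounded hu fun n => hg' n s hsmem).hasSum
  have hshift := (hasSum_nat_add_iff' 1).2 hsum
  simp only [sum_range_one, CharP.cast_eq_zero, zero_mul, mul_zero, sub_zero] at hshift
  convert! hshift using 2 with k
  rw [Nat.add_sub_cancel]
  push_cast
  ring

/-- The iterated derivatives of a power series converging on `(-1, 1)`. -/
theorem hasSum_iteratedDerivWithin_of_hasSum_pow (p : ℕ) {a : ℕ → ℝ} {f : ℝ → ℝ}
    (hf : ∀ s ∈ Set.Ioo (-1 : ℝ) 1, HasSum (fun k => a k * s ^ k) (f s))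
    {s : ℝ} (hs : s ∈ Set.Ioo (-1 : ℝ) 1) :
    HasSum (fun k : ℕ => ((k + p).factorial : ℝ) / (k.factorial : ℝ) * a (k + p) * s ^ k)
      (iteratedDerivWithin p f (Set.Ioo (-1 : ℝ) 1) s) := by
  induction p generalizing a f with
  | zero =>
    simpa [div_self, Nat.factorial_ne_zero] using hf s hs
  | succ p ih =>
    rw [iteratedDerivWithin_succ']
    have h : ∀ x ∈ Set.Ioo (-1 : ℝ) 1, HasSum (fun k : ℕ => ((k : ℝ) + 1) * a (k + 1) * x ^ k)
        (derivWithin f (Set.Ioo (-1 : ℝ) 1) x) := by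
      intro x hx
      rw [derivWithin_of_isOpen isOpen_Ioo hx]
      exact hasSum_deriv_of_hasSum_pow hf hx
    convert! ih h using 2 with k
    rw [← add_assoc, Nat.factorial_succ]
    push_cast
    ring

theorem H_succ (n : ℕ) : H (n + 1) = H n + 1 / ((n : ℝ) + 1) := by
  simp [H, Finset.sum_range_succ]

theorem H_zero : H 0 = 0 := by simp [H]

theorem H_nonneg (n : ℕ) : 0 ≤ H n := Finset.sum_nonneg fun _ _ => by positivity

theorem H_le (n : ℕ) : H n ≤ n := by
  induction n with
  | zero => simp [H_zero]
  | succ n ih =>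
    have : 1 / ((n : ℝ) + 1) ≤ 1 :=
      (div_le_one (by positivity)).2 (by linarith [n.cast_nonneg (α := ℝ)])
    rw [H_succ]
    push_cast
    linarith

theorem sum_range_inv_mul_inv (n : ℕ) :
    ∑ k ∈ Finset.range (n + 1), 1 / ((k : ℝ) + 1) * (1 / (((n - k : ℕ) : ℝ) + 1)) =
      2 * H (n + 1) / ((n : ℝ) + 2) := by
  have hrefl : ∑ k ∈ Finset.range (n + 1), 1 / (((n - k : ℕ) : ℝ) + 1) = H (n + 1) := by
    simpa [H] using Finset.sum_range_reflect (fun k : ℕ => 1 / ((k : ℝ) + 1)) (n + 1)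
  have hterm : ∀ k ∈ Finset.range (n + 1),
      1 / ((k : ℝ) + 1) * (1 / (((n - k : ℕ) : ℝ) + 1)) =
        (1 / ((k : ℝ) + 1) + 1 / (((n - k : ℕ) : ℝ) + 1)) / ((n : ℝ) + 2) := by
    intro k hk
    obtain ⟨m, rfl⟩ := Nat.exists_eq_add_of_le (Finset.mem_range_succ_iff.1 hk)
    rw [Nat.add_sub_cancel_left]
    push_cast
    field_simp
    ring
  rw [Finset.sum_congr rfl hterm, ← Finset.sum_div, Finset.sum_add_distrib, hrefl]
  simp only [H]
  ring

theorem hasSum_log_one_sub_sq {s : ℝ} (hs : |s| < 1) :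
    HasSum (fun n : ℕ => 2 * H n / ((n : ℝ) + 1) * s ^ (n + 1)) (Real.log (1 - s) ^ 2) := by
  have hlog := Real.hasSum_pow_div_log_of_abs_lt_one hs
  have hprod := hasSum_sum_range_mul_of_summable_norm hlog.summable.norm hlog.summable.norm
  rw [hlog.tsum_eq, neg_mul_neg, ← sq] at hprod
  rw [← hasSum_nat_add_iff' 1]
  simp only [Finset.sum_range_one, H_zero, mul_zero, zero_div, zero_mul, sub_zero]
  convert! hprod using 2 with n
  have h := sum_range_inv_mul_inv n
  push_cast
  rw [add_assoc, one_add_one_eq_two, ← h, Finset.sum_mul]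
  refine Finset.sum_congr rfl fun k hk => ?_
  obtain ⟨m, rfl⟩ := Nat.exists_eq_add_of_le (Finset.mem_range_succ_iff.1 hk)
  rw [Nat.add_sub_cancel_left]
  ring

theorem hasSum_Li2 {s : ℝ} (hs : |s| < 1) :
    HasSum (fun k : ℕ => s ^ (k + 1) / ((k : ℝ) + 1) ^ 2) (Li2 s) := by
  refine Summable.hasSum (.of_norm_bounded (summable_geometric_of_lt_one (abs_nonneg s) hs) ?_)
  intro k
  rw [Real.norm_eq_abs, abs_div, abs_pow, abs_of_pos (by positivity : (0 : ℝ) < (k + 1) ^ 2)]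
  have hk : (1 : ℝ) ≤ ((k : ℝ) + 1) ^ 2 :=
    one_le_pow₀ (by linarith [k.cast_nonneg (α := ℝ)])
  exact (div_le_self (by positivity) hk).trans
    (pow_le_pow_of_le_one (abs_nonneg s) hs.le k.le_succ)

theorem hasSum_H_sq_mul_pow {s : ℝ} (hs : |s| < 1) :
    HasSum (fun k : ℕ => H k ^ 2 * s ^ k) ((Li2 s + Real.log (1 - s) ^ 2) / (1 - s)) := by
  have hsum : Summable fun k : ℕ => H k ^ 2 * s ^ k := by
    have hO : (fun k : ℕ => H k ^ 2) =O[Filter.atTop] fun k : ℕ => ((k ^ 2 : ℕ) : ℝ) := by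
      refine Asymptotics.IsBigO.of_bound 1 (Filter.Eventually.of_forall fun n => ?_)
      simpa using pow_le_pow_left₀ (H_nonneg n) (H_le n) 2
    have hs' : ‖s‖ < 1 := hs
    exact (summable_norm_mul_geometric_of_norm_lt_one' hs' hO).of_norm
  obtain ⟨S, hS⟩ := hsum
  have hshift := (hasSum_nat_add_iff' 1).2 hS
  simp only [Finset.sum_range_one, H_zero, ne_eq, OfNat.ofNat_ne_zero, not_false_eq_true, zero_pow,
    zero_mul, sub_zero] at hshift
  have hdiff := hshift.sub (hS.mul_left s)
  have hlhs := (hasSum_Li2 hs).add (hasSum_log_one_sub_sq hs)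
  have key : S - s * S = Li2 s + Real.log (1 - s) ^ 2 := by
    refine hdiff.unique ?_
    convert! hlhs using 2 with n
    rw [H_succ]
    field_simp
    ring
  have hne : 1 - s ≠ 0 := (sub_pos.2 (abs_lt.1 hs).2).ne'
  rwa [← key, show (S - s * S) / (1 - s) = S by field_simp]

theorem stmt_7 (p : ℕ) (t : ℝ) (ht0 : 0 ≤ t) (ht1 : t < 1) :
    HasSum (fun k : ℕ => ((k + p).factorial : ℝ) / (k.factorial : ℝ) * H (k + p) ^ 2 * t ^ k)
      (iteratedDerivWithin p
        (fun s : ℝ => (Li2 s + Real.log (1 - s) ^ 2) / (1 - s))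
        (Set.Ioo (-1 : ℝ) 1) t) :=
  hasSum_iteratedDerivWithin_of_hasSum_pow p (a := fun k => H k ^ 2)
    (fun _ hs => hasSum_H_sq_mul_pow (abs_lt.2 hs)) ⟨by linarith, ht1⟩
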